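/- The permanent of every $4$-dimensional polystochastic matrix of order $4$ is strictly greater than zero. Equivalently, every $4$-dimensional polystochastic matrix of order $4$ contains a positive diagonal. -/

import Mathlib

/-- A multidimensional matrix is polystochastic if all entries are nonnegative
and the sum over every line (all coordinates fixed but one) equals 1. -/
def Polystochastic {d n : ℕ} (A : (Fin d → Fin n) → ℝ) : Prop :=
  (∀ α, 0 ≤ A α) ∧
    ∀ (α : Fin d → Fin n) (j : Fin d), ∑ x : Fin n, A (Function.update α j x) = 1

/-- The permanent of a 4-dimensional matrix of order 4: the sum over all triples
of permutations `(σ₂, σ₃, σ₄)` of the products over the diagonals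
`(i, σ₂ i, σ₃ i, σ₄ i)`. -/
def mper4 (A : (Fin 4 → Fin 4) → ℝ) : ℝ :=
  ∑ σ : Fin 3 → Equiv.Perm (Fin 4),
    ∏ i : Fin 4, A ![i, σ 0 i, σ 1 i, σ 2 i]

open Equiv in
/-- Every positive entry of a doubly stochastic matrix lies on a positive diagonal. -/
theorem exists_perm_pos_of_mem_doublyStochastic {n : Type*} [Fintype n] [DecidableEq n]
    {M : Matrix n n ℝ} (hM : M ∈ doublyStochastic ℝ n) {i j : n} (hij : 0 < M i j) :
    ∃ σ : Perm n, σ i = j ∧ ∀ k, 0 < M k (σ k) := by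
  obtain ⟨w, hw, -, rfl⟩ := exists_eq_sum_perm_of_mem_doublyStochastic hM
  simp only [Matrix.sum_apply, Matrix.smul_apply, smul_eq_mul] at hij ⊢
  have hnonneg (k l : n) (σ : Perm n) : 0 ≤ w σ * σ.permMatrix ℝ k l :=
    mul_nonneg (hw σ) (nonneg_of_mem_doublyStochastic permMatrix_mem_doublyStochastic)
  obtain ⟨σ, -, hσ⟩ := (Finset.sum_pos_iff_of_nonneg fun σ _ => hnonneg i j σ).1 hij
  obtain rfl : σ i = j := by
    by_contra h
    simp [PEquiv.toMatrix_apply, h] at hσ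
  have hwσ : 0 < w σ := (hw σ).lt_of_ne' (left_ne_zero_of_mul hσ.ne')
  refine ⟨σ, rfl, fun k => Finset.sum_pos' (fun τ _ => hnonneg _ _ τ) ⟨σ, Finset.mem_univ _, ?_⟩⟩
  simpa [PEquiv.toMatrix_apply] using hwσ

namespace Polystochastic

variable {A : (Fin 4 → Fin 4) → ℝ}

theorem sum_coord_zero (hA : Polystochastic A) (b c d : Fin 4) :
    ∑ x, A ![x, b, c, d] = 1 := by
  rw [← hA.2 ![0, b, c, d] 0]
  refine Finset.sum_congr rfl fun x _ => congrArg A ?_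
  ext i; fin_cases i <;> rfl

theorem sum_coord_one (hA : Polystochastic A) (a c d : Fin 4) :
    ∑ x, A ![a, x, c, d] = 1 := by
  rw [← hA.2 ![a, 0, c, d] 1]
  refine Finset.sum_congr rfl fun x _ => congrArg A ?_
  ext i; fin_cases i <;> rfl

theorem sum_coord_two (hA : Polystochastic A) (a b d : Fin 4) :
    ∑ x, A ![a, b, x, d] = 1 := by
  rw [← hA.2 ![a, b, 0, d] 2]
  refine Finset.sum_congr rfl fun x _ => congrArg A ?_
  ext i; fin_cases i <;> rfl

theorem sum_coord_three (hA : Polystochastic A) (a b c : Fin 4) :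
    ∑ x, A ![a, b, c, x] = 1 := by
  rw [← hA.2 ![a, b, c, 0] 3]
  refine Finset.sum_congr rfl fun x _ => congrArg A ?_
  ext i; fin_cases i <;> rfl

/-- A positive entry extends to a positive diagonal of the plane obtained by fixing the
last two coordinates. -/
theorem exists_perm_pos_left (hA : Polystochastic A) {a b c d : Fin 4}
    (h : 0 < A ![a, b, c, d]) :
    ∃ ρ : Equiv.Perm (Fin 4), ρ a = b ∧ ∀ k, 0 < A ![k, ρ k, c, d] := by
  have hM : (Matrix.of fun k l => A ![k, l, c, d]) ∈ doublyStochastic ℝ (Fin 4) :=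
    mem_doublyStochastic_iff_sum.2 ⟨fun _ _ => hA.1 _, fun k => hA.sum_coord_one k c d,
      fun l => hA.sum_coord_zero l c d⟩
  exact exists_perm_pos_of_mem_doublyStochastic hM h

/-- A positive entry extends to a positive diagonal of the plane obtained by fixing the
first two coordinates. -/
theorem exists_perm_pos_right (hA : Polystochastic A) {a b c d : Fin 4}
    (h : 0 < A ![a, b, c, d]) :
    ∃ τ : Equiv.Perm (Fin 4), τ c = d ∧ ∀ r, 0 < A ![a, b, r, τ r] := by
  have hM : (Matrix.of fun k l => A ![a, b, k, l]) ∈ doublyStochastic ℝ (Fin 4) :=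
    mem_doublyStochastic_iff_sum.2 ⟨fun _ _ => hA.1 _, fun k => hA.sum_coord_three a b k,
      fun l => hA.sum_coord_two a b l⟩
  exact exists_perm_pos_of_mem_doublyStochastic hM h

end Polystochastic

theorem mper4_pos_of_diagonal {A : (Fin 4 → Fin 4) → ℝ} (hA : ∀ α, 0 ≤ A α)
    (σ₂ σ₃ σ₄ : Equiv.Perm (Fin 4)) (h : ∀ i, 0 < A ![i, σ₂ i, σ₃ i, σ₄ i]) :
    0 < mper4 A :=
  Finset.sum_pos' (fun _ _ => Finset.prod_nonneg fun _ _ => hA _)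
    ⟨![σ₂, σ₃, σ₄], Finset.mem_univ _, Finset.prod_pos fun i _ => h i⟩

/-- Four permutations of `Fin 4` agreeing at `0` either have a transversal, or the first of them
equals another one. -/
theorem exists_transversal_or_eq (τ : Fin 4 → Equiv.Perm (Fin 4)) (hτ : ∀ k, τ k 0 = τ 0 0) :
    (∃ σ : Equiv.Perm (Fin 4), Function.Injective fun k => τ k (σ k)) ∨ ∃ a ≠ 0, τ a = τ 0 := by
  have key : ∀ τ₁ : Equiv.Perm (Fin 4), τ₁ 0 = 0 → τ₁ ≠ 1 →
      ∀ τ₂ : Equiv.Perm (Fin 4), τ₂ 0 = 0 → τ₂ ≠ 1 →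
      ∀ τ₃ : Equiv.Perm (Fin 4), τ₃ 0 = 0 → τ₃ ≠ 1 →
      ∃ σ : Equiv.Perm (Fin 4), Function.Injective ![σ 0, τ₁ (σ 1), τ₂ (σ 2), τ₃ (σ 3)] := by
    decide +kernel
  refine or_iff_not_imp_right.2 fun h => ?_
  push Not at h
  have hfix (k : Fin 4) : ((τ 0)⁻¹ * τ k) 0 = 0 := by simp [hτ k]
  have hne (k : Fin 4) (hk : k ≠ 0) : (τ 0)⁻¹ * τ k ≠ 1 := fun h' =>
    h k hk (inv_mul_eq_one.1 h').symm
  obtain ⟨σ, hσ⟩ := key _ (hfix 1) (hne 1 (by decide)) _ (hfix 2) (hne 2 (by decide))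
    _ (hfix 3) (hne 3 (by decide))
  refine ⟨σ, ?_⟩
  convert (τ 0).injective.comp hσ using 1
  ext k
  fin_cases k <;> simp

/-- A `4 × 4` board on which row `0`, column `0`, another row and another column are available
has an available diagonal. -/
theorem exists_perm_of_two_rows_two_columns : ∀ a m : Fin 4, a ≠ 0 → m ≠ 0 →
    ∃ σ : Equiv.Perm (Fin 4), ∀ k, k = 0 ∨ k = a ∨ σ k = 0 ∨ σ k = m := by
  decide +kernel

/-- The permanent of every 4-dimensional polystochastic matrix of order 4 is
strictly positive. -/
theorem perm_pos_of_polystochastic_dim4_order4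
    (A : (Fin 4 → Fin 4) → ℝ) (hA : Polystochastic A) :
    0 < mper4 A := by
  obtain ⟨d, hd⟩ : ∃ d, 0 < A ![0, 0, 0, d] := by
    by_contra! h
    linarith [hA.sum_coord_three 0 0 0, Finset.sum_nonpos fun d (_ : d ∈ Finset.univ) => h d]
  obtain ⟨ρ₀, hρ₀, hρ₀A⟩ := hA.exists_perm_pos_left hd
  obtain ⟨τ₀, hτ₀, hτ₀A⟩ := hA.exists_perm_pos_right hd
  have hτ_ex (k : Fin 4) : ∃ τ : Equiv.Perm (Fin 4),
      τ 0 = d ∧ (∀ r, 0 < A ![k, ρ₀ k, r, τ r]) ∧ (k = 0 → τ = τ₀) := by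
    by_cases hk : k = 0
    · exact ⟨τ₀, hτ₀, by simpa [hk, hρ₀] using hτ₀A, fun _ => rfl⟩
    · obtain ⟨τ, hτ, hτA⟩ := hA.exists_perm_pos_right (hρ₀A k)
      exact ⟨τ, hτ, hτA, fun h => absurd h hk⟩
  have hρ_ex (r : Fin 4) : ∃ ρ : Equiv.Perm (Fin 4),
      ρ 0 = 0 ∧ (∀ k, 0 < A ![k, ρ k, r, τ₀ r]) ∧ (r = 0 → ρ = ρ₀) := by
    by_cases hr : r = 0
    · exact ⟨ρ₀, hρ₀, by simpa [hr, hτ₀] using hρ₀A, fun _ => rfl⟩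
    · obtain ⟨ρ, hρ, hρA⟩ := hA.exists_perm_pos_left (hτ₀A r)
      exact ⟨ρ, hρ, hρA, fun h => absurd h hr⟩
  choose τ hτ hτA hτ_zero using hτ_ex
  choose ρ hρ hρA hρ_zero using hρ_ex
  rcases exists_transversal_or_eq τ (by simp [hτ]) with ⟨σ, hσ⟩ | ⟨a, ha, hτa⟩
  · exact mper4_pos_of_diagonal hA.1 ρ₀ σ (.ofBijective _ (Finite.injective_iff_bijective.1 hσ))
      fun k => hτA k (σ k)
  rcases exists_transversal_or_eq ρ (by simp [hρ]) with ⟨σ, hσ⟩ | ⟨m, hm, hρm⟩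
  · let π : Equiv.Perm (Fin 4) := .ofBijective _ (Finite.injective_iff_bijective.1 hσ)
    refine mper4_pos_of_diagonal hA.1 (σ⁻¹.trans π) σ⁻¹ (σ⁻¹.trans τ₀) fun k => ?_
    simpa [π] using hρA (σ⁻¹ k) k
  obtain ⟨σ, hσ⟩ := exists_perm_of_two_rows_two_columns a m ha hm
  refine mper4_pos_of_diagonal hA.1 ρ₀ σ (σ.trans τ₀) fun k => ?_
  rw [hτ_zero 0 rfl] at hτa
  rw [hρ_zero 0 rfl] at hρm
  rcases hσ k with h | h | h | h
  · simpa [hτ_zero k h] using hτA k (σ k)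
  · simpa [h, hτa] using hτA k (σ k)
  · simpa [hρ_zero _ h] using hρA (σ k) k
  · simpa [h, hρm] using hρA (σ k) k
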